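/- arXiv:2404.10695 — 2 statements merged into one kernel-verified Lean document; each statement's English description precedes it below -/
import Mathlib

section
/- For every integer n ≥ 1, the strong-coupling perturbative coefficient b_{2n} of the logarithm of the spectral trace of local ℙ² is recovered as the Mellin transform of the weak-coupling discontinuity: b_{2n} = ((−1)^n/π) · ∫_0^∞ τ^{-2n} · (Σ_{m=1}^∞ R_m e^{-2πm/(3τ)}) dτ, where the integral is over real τ > 0 and the series converges for every τ > 0. -/
open scoped Real
open MeasureTheory

noncomputable section

/-- The nonprincipal Dirichlet character modulo 3. -/
def chi (n : ℤ) : ℤ := if n % 3 = 1 then 1 else if n % 3 = 2 then -1 else 0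

/-- The strong-coupling Stokes constants of local ℙ². -/
def R (n : ℕ) : ℂ := 3 * ∑ d ∈ n.divisors, (chi d : ℂ) * d / n

/-- The strong-coupling perturbative coefficients `b_{2n}` of the logarithm of the
spectral trace of local ℙ²:
`b_{2n} = (−1)^n √3 (6π)^{2n−1} B_{2n} B_{2n−1}(2/3) / ((2n)! (2n−1))`. -/
def b (n : ℕ) : ℂ :=
  (-1 : ℂ) ^ n * (Real.sqrt 3 : ℂ) * ((6 * π : ℝ) : ℂ) ^ (2 * n - 1) *
      ((bernoulli (2 * n) : ℚ) : ℂ) *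
      (((Polynomial.bernoulli (2 * n - 1)).eval (2 / 3 : ℚ) : ℚ) : ℂ) /
    ((Nat.factorial (2 * n) : ℂ) * ((2 * n - 1 : ℕ) : ℂ))


open Filter Topology Set

lemma chi_natCast_add_three (n : ℕ) : chi ((n + 3 : ℕ) : ℤ) = chi n := by
  simp [chi]

lemma abs_chi_le_one (n : ℤ) : |(chi n : ℝ)| ≤ 1 := by
  unfold chi
  split_ifs <;> simp

lemma sin_two_pi_mul_two_thirds (n : ℕ) :
    Real.sin (2 * π * n * (2 / 3)) = -(√3 / 2) * chi n := by
  have h₁ : Real.sin (2 * π * (2 / 3)) = -(√3 / 2) := by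
    rw [show 2 * π * (2 / 3) = π / 3 + π by ring, Real.sin_add_pi, Real.sin_pi_div_three]
  have h₂ : Real.sin (2 * π * 2 * (2 / 3)) = √3 / 2 := by
    rw [show 2 * π * 2 * (2 / 3) = (π - π / 3) + 2 * π by ring, Real.sin_add_two_pi,
      Real.sin_pi_sub, Real.sin_pi_div_three]
  induction n using Nat.strong_induction_on with
  | _ n ih =>
    match n with
    | 0 => simp [chi]
    | 1 => simp [chi, h₁]
    | 2 => simp [chi, h₂]
    | n + 3 =>
      rw [chi_natCast_add_three, ← ih n (by omega)]
      push_cast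
      rw [show 2 * π * (n + 3) * (2 / 3) = 2 * π * n * (2 / 3) + (2 : ℕ) * (2 * π) by
        push_cast; ring, Real.sin_add_nat_mul_two_pi]

/-- The generating function `∑ d ≥ 1, χ(d) e^{-dx}` in closed form. -/
def chiKernel (x : ℝ) : ℝ := (Real.exp x + 1 + Real.exp (-x))⁻¹

lemma chiKernel_pos (x : ℝ) : 0 < chiKernel x := by
  unfold chiKernel
  positivity

lemma chiKernel_le (x : ℝ) : chiKernel x ≤ Real.exp (-x) := by
  rw [chiKernel, Real.exp_neg x]
  have := Real.exp_pos x
  exact inv_anti₀ this (by linarith [inv_pos.2 this])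

lemma continuous_chiKernel : Continuous chiKernel := by
  unfold chiKernel
  exact Continuous.inv₀ (by fun_prop) fun x => by positivity

lemma hasSum_chi_exp {x : ℝ} (hx : 0 < x) :
    HasSum (fun d : ℕ+ => (chi d : ℝ) * Real.exp (-(d * x))) (chiKernel x) := by
  set q := Real.exp (-x) with hq
  have hq0 : 0 < q := Real.exp_pos _
  have hq1 : q < 1 := by simpa [hq] using hx
  have hs : Summable fun d : ℕ => (chi d : ℝ) * q ^ d := by
    refine (summable_geometric_of_lt_one hq0.le hq1).of_norm_bounded fun d => ?_
    rw [norm_mul, Real.norm_eq_abs, Real.norm_of_nonneg (by positivity)]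
    exact mul_le_of_le_one_left (by positivity) (abs_chi_le_one _)
  have h : HasSum (fun d : ℕ => (chi d : ℝ) * q ^ d) (chiKernel x) := by
    rw [hs.hasSum_iff]
    have h3 := hs.sum_add_tsum_nat_add 3
    simp_rw [chi_natCast_add_three, pow_add, ← mul_assoc, tsum_mul_right] at h3
    generalize ∑' d : ℕ, (chi d : ℝ) * q ^ d = S at h3
    simp only [Finset.sum_range_succ, Finset.sum_range_zero] at h3
    norm_num [chi] at h3
    have he : Real.exp x = q⁻¹ := by rw [hq, Real.exp_neg, inv_inv]
    rw [chiKernel, he, ← hq]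
    have hne : (1 - q) ≠ 0 := by linarith
    have hS : S * (1 + q + q ^ 2) = q := mul_left_cancel₀ hne (by linear_combination -h3)
    have : q⁻¹ + 1 + q = (1 + q + q ^ 2) / q := by field_simp
    rw [this, inv_div, eq_div_iff (by positivity), hS]
  have := hasSum_pnat_iff (f := fun d : ℕ => (chi d : ℝ) * q ^ d) (a := chiKernel x)
  simp only [Nat.cast_zero, pow_zero, mul_one] at this
  convert! this.2 (by simpa [chi] using h) using 3 with d
  rw [hq, ← Real.exp_nat_mul]
  congr 1; ring

lemma summable_chi_div_mul_exp {x : ℝ} (hx : 0 < x) :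
    Summable fun p : ℕ+ × ℕ+ => (chi p.1 : ℝ) / p.2 * Real.exp (-(p.1 * p.2 * x)) := by
  have hg : Summable fun d : ℕ+ => Real.exp (-(d * x)) := by
    have : Summable fun d : ℕ => Real.exp (-(d * x)) := by
      simpa using Real.summable_exp_nat_mul_iff.2 (neg_lt_zero.2 hx)
    exact summable_pnat_iff_summable_nat.2 this
  refine ((hg.mul_of_nonneg hg (fun _ => by positivity) fun _ => by positivity).mul_left
    (Real.exp x)).of_norm_bounded fun ⟨d, e⟩ => ?_
  have hd : (1 : ℝ) ≤ d := by exact_mod_cast one_le (a := d)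
  have he : (1 : ℝ) ≤ e := by exact_mod_cast one_le (a := e)
  rw [norm_mul, norm_div, Real.norm_eq_abs, Real.norm_of_nonneg (by positivity),
    Real.norm_of_nonneg (Real.exp_pos _).le, ← Real.exp_add, ← Real.exp_add]
  refine (mul_le_of_le_one_left (Real.exp_pos _).le
    (div_le_one_of_le₀ ((abs_chi_le_one _).trans he) (by positivity))).trans ?_
  rw [Real.exp_le_exp]
  dsimp only
  nlinarith [mul_nonneg (mul_nonneg (sub_nonneg.2 hd) (sub_nonneg.2 he)) hx.le]

/-- One third of the Stokes constant `R m`, as a real number. -/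
def stokesThird (m : ℕ) : ℝ := ∑ d ∈ m.divisors, (chi d : ℝ) * d / m

lemma R_eq_ofReal (m : ℕ) : R m = ((3 * stokesThird m : ℝ) : ℂ) := by
  simp [R, stokesThird]

/-- The Lambert series rearrangement of the Stokes series. -/
lemma exists_hasSum_stokesThird_exp {x : ℝ} (hx : 0 < x) :
    ∃ S, HasSum (fun m : ℕ+ => stokesThird m * Real.exp (-(m * x))) S ∧
      HasSum (fun e : ℕ+ => chiKernel (e * x) / e) S := by
  have hs := (summable_chi_div_mul_exp hx).hasSum
  refine ⟨_, ((sigmaAntidiagonalEquivProd.hasSum_iff).2 hs).sigma fun m => ?_,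
    (((Equiv.prodComm ℕ+ ℕ+).hasSum_iff).2 hs).prod_fiberwise fun e => ?_⟩
  · convert! hasSum_fintype _ using 1
    rw [stokesThird, Finset.sum_mul, ← Nat.sum_divisorsAntidiagonal
      (fun d _ => (chi d : ℝ) * d / m * Real.exp (-(m * x))), ← Finset.sum_coe_sort]
    refine Finset.sum_congr rfl fun p _ => ?_
    obtain ⟨⟨d, e⟩, hp⟩ := p
    obtain ⟨hde, -⟩ := Nat.mem_divisorsAntidiagonal.1 hp
    have hm : (m : ℝ) = d * e := by exact_mod_cast hde.symm
    have hm0 : (m : ℝ) ≠ 0 := by positivity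
    have hd : (d : ℝ) ≠ 0 := fun h => hm0 (by rw [hm, h, zero_mul])
    have he : (e : ℝ) ≠ 0 := fun h => hm0 (by rw [hm, h, mul_zero])
    simp only [sigmaAntidiagonalEquivProd, divisorsAntidiagonalFactors, Function.comp_apply,
      Equiv.coe_fn_mk, PNat.mk_coe, hm]
    field_simp
  · have he : (0 : ℝ) < e := by positivity
    convert! (hasSum_chi_exp (mul_pos he hx)).div_const (e : ℝ) using 2 with d
    simp only [Function.comp_apply, Equiv.prodComm_apply, Prod.swap_prod_mk]
    ring_nf

lemma integral_pow_mul_exp_neg_mul_Ioi (k : ℕ) {r : ℝ} (hr : 0 < r) :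
    ∫ x in Ioi (0 : ℝ), x ^ k * Real.exp (-(r * x)) = k.factorial / r ^ (k + 1) := by
  have h := Real.integral_rpow_mul_exp_neg_mul_Ioi (a := k + 1) (by positivity) hr
  rw [Real.Gamma_nat_eq_factorial, show ((k : ℝ) + 1) = ((k + 1 : ℕ) : ℝ) by push_cast; ring,
    Real.rpow_natCast] at h
  simp only [Nat.cast_add, Nat.cast_one, add_sub_cancel_right, Real.rpow_natCast] at h
  rw [h, one_div, inv_pow, inv_mul_eq_div]

lemma integrableOn_pow_mul_exp_neg_mul_Ioi (k : ℕ) {r : ℝ} (hr : 0 < r) :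
    IntegrableOn (fun x : ℝ => x ^ k * Real.exp (-(r * x))) (Ioi 0) := by
  refine Integrable.of_integral_ne_zero ?_
  rw [integral_pow_mul_exp_neg_mul_Ioi k hr]
  positivity

lemma integrableOn_pow_mul_chiKernel (k : ℕ) :
    IntegrableOn (fun x : ℝ => x ^ k * chiKernel x) (Ioi 0) := by
  refine (integrableOn_pow_mul_exp_neg_mul_Ioi k one_pos).mono'
    ((continuous_pow k).mul continuous_chiKernel).aestronglyMeasurable ?_
  refine (ae_restrict_mem measurableSet_Ioi).mono fun x (hx : 0 < x) => ?_
  rw [norm_mul, Real.norm_of_nonneg (by positivity), Real.norm_of_nonneg (chiKernel_pos x).le,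
    one_mul]
  gcongr
  exact chiKernel_le x

lemma integral_chiKernel : ∫ x in Ioi (0 : ℝ), chiKernel x = π / (3 * √3) := by
  have h3 : (√3) ^ 2 = 3 := Real.sq_sqrt (by norm_num)
  have h3p : 0 < √3 := by positivity
  have hderiv : ∀ x ∈ Ici (0 : ℝ), HasDerivAt
      (fun x => -(2 / √3) * Real.arctan ((2 * Real.exp (-x) + 1) / √3)) (chiKernel x) x := by
    intro x _
    have h := ((((Real.hasDerivAt_exp (-x)).comp x (hasDerivAt_neg x)).const_mul 2).add_const
      1).div_const (√3)
    convert! h.arctan.const_mul (-(2 / √3)) using 1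
    rw [chiKernel, show Real.exp x = (Real.exp (-x))⁻¹ by rw [Real.exp_neg, inv_inv]]
    simp only [Function.comp_apply]
    have hq := Real.exp_pos (-x)
    generalize Real.exp (-x) = q at hq
    rw [div_pow, h3]
    field_simp
    rw [h3]
    ring
  have hlim : Tendsto (fun x => -(2 / √3) * Real.arctan ((2 * Real.exp (-x) + 1) / √3)) atTop
      (𝓝 (-(2 / √3) * Real.arctan ((2 * 0 + 1) / √3))) :=
    ((Real.continuous_arctan.tendsto _).comp
      (((Real.tendsto_exp_neg_atTop_nhds_zero.const_mul 2).add_const 1).div_const _)).const_mul _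
  rw [integral_Ioi_of_hasDerivAt_of_tendsto' hderiv
    (by simpa using integrableOn_pow_mul_chiKernel 0) hlim]
  have h1 : (2 * 0 + 1) / √3 = (√3)⁻¹ := by simp
  have h2 : (2 * Real.exp (-0) + 1) / √3 = √3 := by
    rw [neg_zero, Real.exp_zero, div_eq_iff h3p.ne']
    nlinarith
  rw [h1, h2, Real.arctan_inv_sqrt_three, Real.arctan_sqrt_three]
  field_simp
  ring

/-- The value `B_k(2/3)` of the Bernoulli polynomial, as a real number. -/
def bernoulliTwoThirds (k : ℕ) : ℝ := ((Polynomial.bernoulli k).eval (2 / 3 : ℚ) : ℚ)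

lemma hasSum_chi_div_pow {k : ℕ} (hk : k ≠ 0) :
    HasSum (fun d : ℕ+ => (chi d : ℝ) / (d : ℝ) ^ (2 * k + 1))
      ((-1) ^ k * (2 * π) ^ (2 * k + 1) / (√3 * (2 * k + 1).factorial) *
        bernoulliTwoThirds (2 * k + 1)) := by
  have h := (hasSum_one_div_nat_pow_mul_sin hk (x := 2 / 3) (by norm_num)).mul_left (-(2 / √3))
  have hB : (Polynomial.map (algebraMap ℚ ℝ) (Polynomial.bernoulli (2 * k + 1))).eval (2 / 3) =
      bernoulliTwoThirds (2 * k + 1) := by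
    rw [show (2 / 3 : ℝ) = algebraMap ℚ ℝ (2 / 3) by norm_num, Polynomial.eval_map_apply]
    simp [bernoulliTwoThirds]
  rw [hB] at h
  simp_rw [sin_two_pi_mul_two_thirds] at h
  have h3p : 0 < √3 := by positivity
  refine (hasSum_pnat_iff (f := fun d : ℕ => (chi d : ℝ) / (d : ℝ) ^ (2 * k + 1))).2 ?_
  convert! h using 1
  · ext d
    field_simp
  · rw [pow_succ (-1 : ℝ)]
    field_simp
    simp

lemma integral_pow_mul_chiKernel (k : ℕ) :
    ∫ x in Ioi (0 : ℝ), x ^ (2 * k) * chiKernel x =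
      (-1) ^ k * (2 * π) ^ (2 * k + 1) / (√3 * (2 * k + 1)) *
        bernoulliTwoThirds (2 * k + 1) := by
  rcases eq_or_ne k 0 with rfl | hk
  · simp only [mul_zero, pow_zero, one_mul, integral_chiKernel, zero_add,
      bernoulliTwoThirds, Polynomial.bernoulli_one]
    norm_num
    field_simp
    norm_num
  · have hnorm : ∀ d : ℕ+, ∀ x ∈ Ioi (0 : ℝ),
        ‖x ^ (2 * k) * ((chi d : ℝ) * Real.exp (-(d * x)))‖ =
          |(chi d : ℝ)| * (x ^ (2 * k) * Real.exp (-(d * x))) := by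
      intro d x (hx : 0 < x)
      rw [norm_mul, norm_mul, Real.norm_of_nonneg (by positivity),
        Real.norm_of_nonneg (Real.exp_pos _).le, Real.norm_eq_abs]
      ring
    have hd : ∀ d : ℕ+, (0 : ℝ) < d := fun d => by positivity
    have h := hasSum_integral_of_summable_integral_norm (μ := volume.restrict (Ioi 0))
      (F := fun (d : ℕ+) (x : ℝ) => x ^ (2 * k) * ((chi d : ℝ) * Real.exp (-(d * x))))
      (fun d => by
        simpa only [mul_left_comm] using
          (integrableOn_pow_mul_exp_neg_mul_Ioi (2 * k) (hd d)).const_mul (chi d : ℝ))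
      (by
        simp_rw [setIntegral_congr_fun measurableSet_Ioi (hnorm _), integral_const_mul,
          integral_pow_mul_exp_neg_mul_Ioi _ (hd _)]
        have hz : Summable fun d : ℕ+ => ((2 * k).factorial : ℝ) * (1 / (d : ℝ) ^ (2 * k + 1)) :=
          (summable_pnat_iff_summable_nat (f := fun d : ℕ => 1 / (d : ℝ) ^ (2 * k + 1)).2
            (Real.summable_one_div_nat_pow.2 (by omega))).mul_left _
        refine hz.of_nonneg_of_le (fun d => by positivity) fun d => ?_
        rw [mul_one_div]
        exact mul_le_of_le_one_left (by positivity) (abs_chi_le_one _))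
    simp_rw [mul_left_comm _ (chi _ : ℝ), integral_const_mul,
      integral_pow_mul_exp_neg_mul_Ioi _ (hd _)] at h
    have hcongr : ∫ x in Ioi (0 : ℝ), x ^ (2 * k) * chiKernel x =
        ∫ x in Ioi (0 : ℝ), ∑' d : ℕ+, (chi d : ℝ) * (x ^ (2 * k) * Real.exp (-(d * x))) := by
      refine setIntegral_congr_fun measurableSet_Ioi fun x hx => ?_
      rw [← (hasSum_chi_exp hx).tsum_eq, ← tsum_mul_left]
      exact tsum_congr fun d => mul_left_comm _ _ _
    rw [← hcongr] at h
    have h' := (hasSum_chi_div_pow hk).mul_left ((2 * k).factorial : ℝ)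
    rw [h.unique (by simpa only [mul_div_left_comm] using h'), Nat.factorial_succ]
    push_cast
    field_simp

lemma integral_pow_mul_tsum_stokesThird (k : ℕ) :
    ∫ x in Ioi (0 : ℝ), x ^ (2 * k) * ∑' m : ℕ+, stokesThird m * Real.exp (-(m * x)) =
      ((-1) ^ k * 2 ^ (2 * k + 1) * π ^ (2 * k + 2) * bernoulli (2 * k + 2) /
        (2 * k + 2).factorial) * ∫ x in Ioi (0 : ℝ), x ^ (2 * k) * chiKernel x := by
  have he : ∀ e : ℕ+, (0 : ℝ) < e := fun e => by positivity
  set J := ∫ x in Ioi (0 : ℝ), x ^ (2 * k) * chiKernel x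
  have hfun : ∀ e : ℕ+, ∀ x : ℝ, x ^ (2 * k) * (chiKernel (e * x) / e) =
      1 / (e : ℝ) ^ (2 * k + 1) * ((e * x) ^ (2 * k) * chiKernel (e * x)) := by
    intro e x
    have := he e
    rw [mul_pow, pow_succ]
    field_simp
  have hint : ∀ e : ℕ+, IntegrableOn (fun x : ℝ => x ^ (2 * k) * (chiKernel (e * x) / e))
      (Ioi 0) := by
    intro e
    simp_rw [hfun e]
    refine Integrable.const_mul ?_ _
    refine (integrableOn_Ioi_comp_mul_left_iff (fun x => x ^ (2 * k) * chiKernel x) 0 (he e)).2 ?_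
    rw [mul_zero]
    exact integrableOn_pow_mul_chiKernel _
  have hval : ∀ e : ℕ+, ∫ x in Ioi (0 : ℝ), x ^ (2 * k) * (chiKernel (e * x) / e) =
      1 / (e : ℝ) ^ (2 * (k + 1)) * J := by
    intro e
    have := he e
    simp_rw [hfun e, integral_const_mul]
    rw [integral_comp_mul_left_Ioi (fun x => x ^ (2 * k) * chiKernel x) 0 (he e), mul_zero,
      smul_eq_mul, ← mul_assoc]
    congr 1
    rw [show 2 * (k + 1) = 2 * k + 1 + 1 by ring, pow_succ _ (2 * k + 1)]
    field_simp
  have hzeta := (hasSum_pnat_iff (f := fun e : ℕ => 1 / (e : ℝ) ^ (2 * (k + 1)))).2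
    (by simpa using hasSum_zeta_nat (Nat.succ_ne_zero k))
  have h := hasSum_integral_of_summable_integral_norm hint (by
    refine (hzeta.mul_right J).summable.congr fun e => ?_
    rw [← hval e]
    refine (setIntegral_congr_fun measurableSet_Ioi fun x (hx : 0 < x) => ?_)
    exact (Real.norm_of_nonneg (mul_nonneg (pow_nonneg hx.le _)
      (div_nonneg (chiKernel_pos _).le (he e).le))).symm)
  simp_rw [hval] at h
  have hcongr : ∫ x in Ioi (0 : ℝ), x ^ (2 * k) * ∑' m : ℕ+, stokesThird m * Real.exp (-(m * x)) =
      ∫ x in Ioi (0 : ℝ), ∑' e : ℕ+, x ^ (2 * k) * (chiKernel (e * x) / e) := by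
    refine setIntegral_congr_fun measurableSet_Ioi fun x hx => ?_
    obtain ⟨S, h₁, h₂⟩ := exists_hasSum_stokesThird_exp hx
    simp only [tsum_mul_left, h₁.tsum_eq, h₂.tsum_eq]
  rw [hcongr, h.unique (hzeta.mul_right J)]
  congr 1
  rw [show 2 * (k + 1) - 1 = 2 * k + 1 by omega]
  ring_nf

theorem stmt3 (n : ℕ) (hn : 1 ≤ n) :
    (∀ t : ℝ, 0 < t →
      Summable (fun m : ℕ => R (m + 1) * Complex.exp (-(2 * π * (m + 1)) / (3 * t)))) ∧
    b n = ((-1 : ℂ) ^ n / (π : ℂ)) *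
      ∫ t in Set.Ioi (0 : ℝ), (t : ℂ) ^ (-(2 * (n : ℤ))) *
        ∑' m : ℕ, R (m + 1) * Complex.exp (-(2 * π * (m + 1)) / (3 * t)) := by
  have hterm : ∀ t : ℝ, ∀ m : ℕ, R (m + 1) * Complex.exp (-(2 * π * (m + 1)) / (3 * t)) =
      ((3 * (stokesThird (m + 1) *
        Real.exp (-((m + 1 : ℕ) * (2 * π / 3 * t⁻¹)))) : ℝ) : ℂ) := by
    intro t m
    rw [R_eq_ofReal]
    push_cast
    rw [← mul_assoc]
    congr 2
    rw [mul_comm (3 : ℂ) t]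
    ring
  have hsum : ∀ t : ℝ, 0 < t → HasSum
      (fun m : ℕ => R (m + 1) * Complex.exp (-(2 * π * (m + 1)) / (3 * t)))
      ((3 * ∑' m : ℕ+, stokesThird m * Real.exp (-(m * (2 * π / 3 * t⁻¹))) : ℝ) : ℂ) := by
    intro t ht
    obtain ⟨S, hS, -⟩ := exists_hasSum_stokesThird_exp (x := 2 * π / 3 * t⁻¹) (by positivity)
    simp_rw [hterm t]
    refine Complex.hasSum_ofReal.2 (HasSum.mul_left _ ?_)
    rw [hS.tsum_eq]
    exact (hasSum_pnat_iff_hasSum_succ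
      (f := fun m : ℕ => stokesThird m * Real.exp (-(m * (2 * π / 3 * t⁻¹))))).1 hS
  refine ⟨fun t ht => (hsum t ht).summable, ?_⟩
  obtain ⟨k, rfl⟩ : ∃ k, n = k + 1 := ⟨n - 1, by omega⟩
  set f : ℝ → ℝ := fun x => ∑' m : ℕ+, stokesThird m * Real.exp (-(m * x)) with hf
  have hint : ∫ t in Ioi (0 : ℝ), (t : ℂ) ^ (-(2 * ((k + 1 : ℕ) : ℤ))) *
        ∑' m : ℕ, R (m + 1) * Complex.exp (-(2 * π * (m + 1)) / (3 * t)) =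
      ((3 * ((2 * π / 3) ^ (2 * k + 1))⁻¹ * ∫ x in Ioi (0 : ℝ), x ^ (2 * k) * f x : ℝ) : ℂ) := by
    set a := 2 * π / 3 with ha
    have ha0 : 0 < a := by positivity
    have hcov := integral_comp_rpow_Ioi (fun u => u ^ (2 * k) * f (a * u))
      (p := -1) (by norm_num)
    have hmul := integral_comp_mul_left_Ioi (fun x => x ^ (2 * k) * f x) 0 ha0
    simp only [mul_pow, mul_assoc, integral_const_mul, mul_zero, smul_eq_mul] at hmul
    have hreal : ∀ t ∈ Ioi (0 : ℝ), (t : ℂ) ^ (-(2 * ((k + 1 : ℕ) : ℤ))) *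
        ∑' m : ℕ, R (m + 1) * Complex.exp (-(2 * π * (m + 1)) / (3 * t)) =
        ((3 * ((|-1| * t ^ ((-1 : ℝ) - 1)) •
          ((t ^ (-1 : ℝ)) ^ (2 * k) * f (a * t ^ (-1 : ℝ)))) : ℝ) : ℂ) := by
      intro t (ht : 0 < t)
      rw [(hsum t ht).tsum_eq, Real.rpow_neg_one, show ((-1 : ℝ) - 1) = ((-2 : ℤ) : ℝ) by norm_num,
        Real.rpow_intCast, ← Complex.ofReal_zpow, ← Complex.ofReal_mul]
      congr 1
      rw [abs_neg, abs_one, one_mul, smul_eq_mul, inv_pow, zpow_neg, zpow_neg]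
      norm_cast
      rw [show 2 * (k + 1) = 2 * k + 2 by ring, pow_add, mul_inv]
      ring
    rw [setIntegral_congr_fun measurableSet_Ioi hreal, integral_complex_ofReal,
      integral_const_mul, hcov]
    congr 1
    rw [mul_assoc]
    congr 1
    rw [pow_succ, mul_inv, mul_assoc, ← hmul, ← mul_assoc, inv_mul_cancel₀ (by positivity), one_mul]
  rw [hint, hf, integral_pow_mul_tsum_stokesThird, integral_pow_mul_chiKernel,
    bernoulliTwoThirds, b,
    show 2 * (k + 1) - 1 = 2 * k + 1 by omega, show 2 * (k + 1) = 2 * k + 2 by ring]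
  have h3 : ((√3 : ℝ) : ℂ) ^ 2 = 3 := by
    rw [← Complex.ofReal_pow, Real.sq_sqrt (by norm_num)]
    norm_num
  have h3p : ((√3 : ℝ) : ℂ) ≠ 0 := by
    rw [Complex.ofReal_ne_zero]
    positivity
  have hk : (2 * k + 1 : ℂ) ≠ 0 := by exact_mod_cast Nat.succ_ne_zero (2 * k)
  have hfac : ((2 * k + 2).factorial : ℂ) ≠ 0 := by exact_mod_cast Nat.factorial_ne_zero _
  have hπ : (π : ℂ) ≠ 0 := Complex.ofReal_ne_zero.2 Real.pi_ne_zero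
  have hsq : ((-1 : ℂ) ^ k) ^ 2 = 1 := by rw [← pow_mul, mul_comm, pow_mul]; simp
  push_cast
  rw [show (6 * π : ℂ) = 2 * 3 * π by ring]
  simp only [mul_pow, div_pow, pow_succ (-1 : ℂ)]
  field_simp
  rw [hsq, h3]
  ring
end
end

section
/- The function F_R : ℍ → ℂ defined by F_R(y) := f_∞(−1/(3y)) + f₀(y) extends to a holomorphic function on the cut plane ℂ ∖ ℝ_{≤0}; that is, there exists a function G : ℂ → ℂ that is complex-differentiable on ℂ ∖ ℝ_{≤0} and satisfies G(y) = f_∞(−1/(3y)) + f₀(y) for every y with Im(y) > 0. -/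
open scoped Real

noncomputable section

/-- The weak-coupling Stokes constants of local ℙ². -/
def S (n : ℕ) : ℂ := 3 * Real.sqrt 3 * Complex.I * ∑ d ∈ n.divisors, (chi d : ℂ) / d

/-- The generating function of the weak-coupling Stokes constants on the upper half-plane. -/
def f0 (y : ℂ) : ℂ := ∑' n : ℕ, S (n + 1) * Complex.exp (2 * π * Complex.I * (n + 1) * y)

/-- The generating function of the strong-coupling Stokes constants on the upper half-plane. -/
def finf (y : ℂ) : ℂ := ∑' n : ℕ, R (n + 1) * Complex.exp (2 * π * Complex.I * (n + 1) * y)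

section

open Complex

/-- On compact pieces of the slit plane, `‖n y + m‖` is comparable to `n + m` for `n, m ≥ 0`. -/
theorem exists_mul_add_le_norm_mul_add {y : ℂ} (hy : y ∈ slitPlane) :
    ∃ c : ℝ, 0 < c ∧ ∀ w : ℂ, ‖w - y‖ < c → ∀ n m : ℝ, 0 ≤ n → 0 ≤ m →
      c * (n + m) ≤ ‖(n : ℂ) * w + m‖ := by
  obtain ⟨c, hc, h⟩ : ∃ c : ℝ, 0 < c ∧ ∀ n m : ℝ, 0 ≤ n → 0 ≤ m →
      c * (n + m) ≤ ‖(n : ℂ) * y + m‖ := by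
    rcases hy with hre | him
    · refine ⟨min y.re 1, by positivity, fun n m hn hm ↦ ?_⟩
      have h1 : n * y.re + m ≤ ‖(n : ℂ) * y + m‖ := by
        simpa using re_le_norm ((n : ℂ) * y + m)
      nlinarith [mul_le_mul_of_nonneg_right (min_le_left y.re 1) hn,
        mul_le_mul_of_nonneg_right (min_le_right y.re 1) hm]
    · have him' : 0 < |y.im| := abs_pos.mpr him
      refine ⟨(1 + (1 + ‖y‖) / |y.im|)⁻¹, by positivity, fun n m hn hm ↦ ?_⟩
      have h1 : n * |y.im| ≤ ‖(n : ℂ) * y + m‖ := by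
        simpa [abs_mul, abs_of_nonneg hn] using abs_im_le_norm ((n : ℂ) * y + m)
      have h2 : m ≤ ‖(n : ℂ) * y + m‖ + n * ‖y‖ := by
        have := norm_sub_le ((n : ℂ) * y + m) ((n : ℂ) * y)
        simpa [abs_of_nonneg hn, abs_of_nonneg hm] using this
      have h3 : n ≤ ‖(n : ℂ) * y + m‖ / |y.im| := (le_div_iff₀ him').mpr h1
      rw [inv_mul_le_iff₀ (by positivity)]
      calc n + m ≤ ‖(n : ℂ) * y + m‖ + n * (1 + ‖y‖) := by linarith
        _ ≤ ‖(n : ℂ) * y + m‖ + ‖(n : ℂ) * y + m‖ / |y.im| * (1 + ‖y‖) := by gcongr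
        _ = _ := by ring
  refine ⟨c / 2, by positivity, fun w hw n m hn hm ↦ ?_⟩
  have h1 : ‖(n : ℂ) * y + m‖ ≤ ‖(n : ℂ) * w + m‖ + n * ‖w - y‖ := by
    have := norm_sub_le ((n : ℂ) * w + m) ((n : ℂ) * (w - y))
    rw [norm_mul, norm_real, Real.norm_of_nonneg hn] at this
    refine le_trans (le_of_eq ?_) this
    congr 1
    ring
  nlinarith [h n m hn hm, mul_le_mul_of_nonneg_left hw.le hn]

theorem summable_one_div_add_pow_three :
    Summable fun p : ℕ × ℕ ↦ 1 / ((3 * p.1 + 1 : ℝ) + (p.2 + 1)) ^ 3 := by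
  have h : Summable fun n : ℕ ↦ 1 / |(n : ℝ) + 1| ^ (3 / 2 : ℝ) :=
    (Real.summable_one_div_nat_add_rpow 1 (3 / 2)).mpr (by norm_num)
  refine (h.mul_of_nonneg h (fun n ↦ by positivity) (fun n ↦ by positivity)).of_nonneg_of_le
    (fun p ↦ by positivity) fun p ↦ ?_
  have hk : (0 : ℝ) ≤ p.1 := p.1.cast_nonneg
  have hm : (0 : ℝ) ≤ p.2 := p.2.cast_nonneg
  have aux {x : ℝ} (hx : 0 ≤ x) (hxs : x ≤ (3 * p.1 + 1 : ℝ) + (p.2 + 1)) :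
      x ^ (3 / 2 : ℝ) ≤ ((3 * p.1 + 1 : ℝ) + (p.2 + 1)) ^ (3 / 2 : ℝ) :=
    Real.rpow_le_rpow hx hxs (by norm_num)
  rw [abs_of_nonneg (by positivity), abs_of_nonneg (by positivity), div_mul_div_comm, one_mul]
  apply one_div_le_one_div_of_le (by positivity)
  calc ((p.1 : ℝ) + 1) ^ (3 / 2 : ℝ) * ((p.2 : ℝ) + 1) ^ (3 / 2 : ℝ)
      ≤ ((3 * p.1 + 1 : ℝ) + (p.2 + 1)) ^ (3 / 2 : ℝ) *
        ((3 * p.1 + 1 : ℝ) + (p.2 + 1)) ^ (3 / 2 : ℝ) := by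
        exact mul_le_mul (aux (by positivity) (by linarith)) (aux (by positivity) (by linarith))
          (by positivity) (by positivity)
    _ = ((3 * p.1 + 1 : ℝ) + (p.2 + 1)) ^ 3 := by
        rw [← Real.rpow_add (by positivity)]
        norm_num

/-- The term, indexed by `p = (k, m)`, of the half-lattice sum of `χ(n) / (n y + m) ^ 2`, with
`n = 3 k + 1` and `n = 3 k + 2` grouped together and `m` shifted by one. -/
def latticeTerm (p : ℕ × ℕ) (y : ℂ) : ℂ :=
  1 / ((3 * p.1 + 1) * y + (p.2 + 1)) ^ 2 - 1 / ((3 * p.1 + 2) * y + (p.2 + 1)) ^ 2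

/-- The primitive of `latticeTerm p` vanishing at `1`. -/
def latticePrim (p : ℕ × ℕ) (y : ℂ) : ℂ :=
  (y - 1) * (1 / (((3 * p.1 + 1) * y + (p.2 + 1)) * ((3 * p.1 + 1) + (p.2 + 1))) -
    1 / (((3 * p.1 + 2) * y + (p.2 + 1)) * ((3 * p.1 + 2) + (p.2 + 1))))

theorem mul_add_ne_zero_of_mem_slitPlane {y : ℂ} (hy : y ∈ slitPlane) {n m : ℝ} (hn : 0 ≤ n)
    (hm : 0 < m) : (n : ℂ) * y + m ≠ 0 := by
  obtain ⟨c, hc, h⟩ := exists_mul_add_le_norm_mul_add hy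
  have := h y (by simpa using hc) n m hn hm.le
  rw [← norm_pos_iff]
  exact lt_of_lt_of_le (by positivity) this

theorem hasDerivAt_primitive {y n m : ℂ} (h : n * y + m ≠ 0) (h' : n + m ≠ 0) :
    HasDerivAt (fun w ↦ (w - 1) * (1 / ((n * w + m) * (n + m)))) (1 / (n * y + m) ^ 2) y := by
  have h1 : HasDerivAt (fun w : ℂ ↦ (n * w + m) * (n + m)) (n * (n + m)) y := by
    simpa using! (((hasDerivAt_id y).const_mul n).add_const m).mul_const (n + m)
  have h2 := ((hasDerivAt_id y).sub_const 1).mul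
    ((hasDerivAt_const y (1 : ℂ)).div h1 (mul_ne_zero h h'))
  refine h2.congr_deriv ?_
  simp only [id, Pi.div_apply]
  field_simp
  ring

theorem hasDerivAt_latticePrim (p : ℕ × ℕ) {y : ℂ} (hy : y ∈ slitPlane) :
    HasDerivAt (latticePrim p) (latticeTerm p y) y := by
  have ne1 : (3 * p.1 + 1 : ℂ) * y + (p.2 + 1) ≠ 0 := by
    exact_mod_cast mul_add_ne_zero_of_mem_slitPlane hy (n := 3 * p.1 + 1) (m := p.2 + 1)
      (by positivity) (by positivity)
  have ne2 : (3 * p.1 + 2 : ℂ) * y + (p.2 + 1) ≠ 0 := by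
    exact_mod_cast mul_add_ne_zero_of_mem_slitPlane hy (n := 3 * p.1 + 2) (m := p.2 + 1)
      (by positivity) (by positivity)
  have := (hasDerivAt_primitive ne1 (by norm_cast)).sub
    (hasDerivAt_primitive ne2 (by norm_cast))
  refine this.congr_of_eventuallyEq (.of_forall fun w ↦ ?_)
  simp only [latticePrim, Pi.sub_apply]
  ring

theorem exists_latticePrim_bound {y : ℂ} (hy : y ∈ slitPlane) :
    ∃ c : ℝ, 0 < c ∧ Metric.ball y c ⊆ slitPlane ∧ ∃ C : ℝ, ∀ p : ℕ × ℕ, ∀ w ∈ Metric.ball y c,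
      ‖latticePrim p w‖ ≤ C * (1 / ((3 * p.1 + 1 : ℝ) + (p.2 + 1)) ^ 3) := by
  obtain ⟨c, hc, h⟩ := exists_mul_add_le_norm_mul_add hy
  obtain ⟨δ, hδ, hball⟩ := Metric.isOpen_iff.mp isOpen_slitPlane y hy
  refine ⟨min c δ, by positivity, (Metric.ball_subset_ball (min_le_right _ _)).trans hball,
    (‖y‖ + c + 1) * (1 / c + (‖y‖ + c) / c ^ 2), fun p w hw ↦ ?_⟩
  have hwc : ‖w - y‖ < c := by
    rw [Metric.mem_ball, dist_eq_norm] at hw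
    exact hw.trans_le (min_le_left _ _)
  have hw0 : ‖w‖ ≤ ‖y‖ + c := by
    have := norm_le_norm_add_norm_sub' w y
    linarith
  have hw1 : ‖w - 1‖ ≤ ‖y‖ + c + 1 := by
    have := norm_sub_le w 1
    rw [norm_one] at this
    linarith
  set s : ℝ := (3 * p.1 + 1 : ℝ) + (p.2 + 1) with hs
  have hs0 : 0 < s := by positivity
  set u : ℂ := (3 * p.1 + 1) * w + (p.2 + 1) with hu
  set v : ℂ := (3 * p.1 + 2) * w + (p.2 + 1) with hv
  have hu' : c * s ≤ ‖u‖ := by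
    have := h w hwc (3 * p.1 + 1) (p.2 + 1) (by positivity) (by positivity)
    simpa [hu, hs] using this
  have hv' : c * (s + 1) ≤ ‖v‖ := by
    have := h w hwc (3 * p.1 + 2) (p.2 + 1) (by positivity) (by positivity)
    push_cast at this
    refine le_trans (le_of_eq ?_) this
    rw [hs]
    ring
  have hu0 : u ≠ 0 := norm_pos_iff.mp (lt_of_lt_of_le (by positivity) hu')
  have hv0 : v ≠ 0 := norm_pos_iff.mp (lt_of_lt_of_le (by positivity) hv')
  have hsC : (s : ℂ) ≠ 0 := by exact_mod_cast hs0.ne'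
  have hsC' : (s : ℂ) + 1 ≠ 0 := by exact_mod_cast (show s + 1 ≠ 0 by positivity)
  have key : latticePrim p w = (w - 1) * (1 / (v * s * (s + 1)) + w / (u * v * s)) := by
    have e1 : ((3 * p.1 + 1) + (p.2 + 1) : ℂ) = s := by rw [hs]; push_cast; ring
    have e2 : ((3 * p.1 + 2) + (p.2 + 1) : ℂ) = s + 1 := by rw [hs]; push_cast; ring
    have e3 : v = u + w := by rw [hu, hv]; ring
    rw [latticePrim, ← hu, ← hv, e1, e2]
    field_simp
    rw [e3]
    ring
  have hvs : c * s ≤ ‖v‖ := by nlinarith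
  have b1 : ‖1 / (v * s * (s + 1))‖ ≤ 1 / c * (1 / s ^ 3) := by
    have e : ‖(s : ℂ) + 1‖ = s + 1 := by
      rw [← ofReal_one, ← ofReal_add, norm_real, Real.norm_of_nonneg (by positivity)]
    rw [norm_div, norm_one, norm_mul, norm_mul, norm_real, Real.norm_of_nonneg hs0.le, e,
      div_mul_div_comm, one_mul]
    apply one_div_le_one_div_of_le (by positivity)
    calc c * s ^ 3 = c * s * s * s := by ring
      _ ≤ ‖v‖ * s * (s + 1) := by gcongr; linarith
  have b2 : ‖w / (u * v * s)‖ ≤ (‖y‖ + c) / c ^ 2 * (1 / s ^ 3) := by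
    rw [norm_div, norm_mul, norm_mul, norm_real, Real.norm_of_nonneg hs0.le,
      div_mul_div_comm, mul_one]
    apply div_le_div₀ (by positivity) hw0 (by positivity)
    calc c ^ 2 * s ^ 3 = c * s * (c * s) * s := by ring
      _ ≤ ‖u‖ * ‖v‖ * s := by gcongr
  rw [key, norm_mul, mul_assoc (‖y‖ + c + 1), add_mul (1 / c)]
  exact mul_le_mul hw1 ((norm_add_le _ _).trans (add_le_add b1 b2)) (norm_nonneg _) (by positivity)

theorem hasSum_latticeTerm {y : ℂ} (hy : y ∈ slitPlane) :
    HasSum (fun p ↦ latticeTerm p y) (deriv (fun w ↦ ∑' p, latticePrim p w) y) := by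
  obtain ⟨c, hc, hsub, C, hC⟩ := exists_latticePrim_bound hy
  have := hasSum_deriv_of_summable_norm (summable_one_div_add_pow_three.mul_left C)
    (fun p w hw ↦ (hasDerivAt_latticePrim p (hsub hw)).differentiableAt.differentiableWithinAt)
    Metric.isOpen_ball hC (Metric.mem_ball_self hc)
  simpa only [(hasDerivAt_latticePrim _ hy).deriv] using this

theorem hasDerivAt_tsum_latticePrim {y : ℂ} (hy : y ∈ slitPlane) :
    HasDerivAt (fun w ↦ ∑' p, latticePrim p w) (∑' p, latticeTerm p y) y := by
  obtain ⟨c, hc, hsub, C, hC⟩ := exists_latticePrim_bound hy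
  rw [(hasSum_latticeTerm hy).tsum_eq]
  refine DifferentiableAt.hasDerivAt ?_
  refine (differentiableOn_tsum_of_summable_norm (summable_one_div_add_pow_three.mul_left C)
    (fun p w hw ↦ (hasDerivAt_latticePrim p (hsub hw)).differentiableAt.differentiableWithinAt)
    Metric.isOpen_ball hC).differentiableAt (Metric.ball_mem_nhds y hc)

theorem norm_exp_two_pi_I_mul (t : ℝ) (y : ℂ) :
    ‖exp (2 * π * I * t * y)‖ = Real.exp (-(2 * π * t * y.im)) := by
  rw [norm_exp]
  congr 1
  simp [mul_re, mul_im]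

/-- Termwise differentiation of a `q`-series with linearly bounded coefficients. -/
theorem hasDerivAt_tsum_mul_exp {c : ℕ → ℂ} {C : ℝ} (hc : ∀ n, ‖c n‖ ≤ C * n) {y : ℂ}
    (hy : 0 < y.im) :
    HasDerivAt (fun w ↦ ∑' n : ℕ, c (n + 1) * exp (2 * π * I * (n + 1) * w))
      (∑' n : ℕ, 2 * π * I * ((n + 1 : ℕ) * c (n + 1)) * exp (2 * π * I * (n + 1) * y)) y := by
  obtain ⟨r, hr⟩ : ∃ r : ℝ, r = Real.exp (-(2 * π * (y.im / 2))) := ⟨_, rfl⟩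
  have hr1 : ‖r‖ < 1 := by
    rw [hr, Real.norm_of_nonneg (Real.exp_nonneg _), Real.exp_lt_one_iff]
    have := Real.pi_pos
    have : 0 < 2 * π * (y.im / 2) := by positivity
    linarith
  have hsum : Summable fun n : ℕ ↦ C * (((n + 1 : ℕ) : ℝ) ^ 1 * r ^ (n + 1)) :=
    ((summable_nat_add_iff (f := fun n : ℕ ↦ (n : ℝ) ^ 1 * r ^ n) 1).mpr
      (summable_pow_mul_geometric_of_norm_lt_one 1 hr1)).mul_left C
  have hU : IsOpen {w : ℂ | y.im / 2 < w.im} := isOpen_lt continuous_const continuous_im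
  have hd (n : ℕ) (w : ℂ) : HasDerivAt (fun w ↦ c (n + 1) * exp (2 * π * I * (n + 1) * w))
      (2 * π * I * ((n + 1 : ℕ) * c (n + 1)) * exp (2 * π * I * (n + 1) * w)) w := by
    refine ((((hasDerivAt_id w).const_mul (2 * π * I * (n + 1))).cexp).const_mul
      (c (n + 1))).congr_deriv ?_
    push_cast
    simp only [id]
    ring
  have hb (n : ℕ) (w : ℂ) (hw : w ∈ {w : ℂ | y.im / 2 < w.im}) :
      ‖c (n + 1) * exp (2 * π * I * (n + 1) * w)‖ ≤ C * (((n + 1 : ℕ) : ℝ) ^ 1 * r ^ (n + 1)) := by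
    have h1 : ‖exp (2 * π * I * (n + 1) * w)‖ ≤ r ^ (n + 1) := by
      have := norm_exp_two_pi_I_mul (n + 1) w
      push_cast at this
      rw [this, hr, ← Real.exp_nat_mul, Real.exp_le_exp]
      have : 2 * π * (n + 1) * (y.im / 2) ≤ 2 * π * (n + 1) * w.im := by
        have : y.im / 2 < w.im := hw
        gcongr
      push_cast
      linarith
    rw [norm_mul, ← mul_assoc, pow_one]
    exact mul_le_mul (hc _) h1 (norm_nonneg _) ((norm_nonneg _).trans (hc _))
  have hmem : y ∈ {w : ℂ | y.im / 2 < w.im} := by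
    change y.im / 2 < y.im
    linarith
  have hs := hasSum_deriv_of_summable_norm hsum
    (fun n w _ ↦ (hd n w).differentiableAt.differentiableWithinAt) hU hb hmem
  rw [← tsum_congr fun n ↦ (hd n y).deriv, hs.tsum_eq]
  exact ((differentiableOn_tsum_of_summable_norm hsum
    (fun n w _ ↦ (hd n w).differentiableAt.differentiableWithinAt) hU hb).differentiableAt
    (hU.mem_nhds hmem)).hasDerivAt

theorem norm_chi_le (n : ℤ) : ‖(chi n : ℂ)‖ ≤ 1 := by
  unfold chi
  split_ifs <;> simp

theorem norm_R_le (n : ℕ) : ‖R n‖ ≤ 3 * n := by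
  rw [R, norm_mul]
  norm_num
  refine (norm_sum_le_of_le (f := fun d : ℕ ↦ (chi d : ℂ) * d / n) _ (n := fun _ ↦ 1) ?_).trans ?_
  · intro d hd
    have hd' := Nat.divisor_le hd
    rw [norm_div, norm_mul, norm_natCast, norm_natCast]
    apply div_le_one_of_le₀ _ (by positivity)
    calc ‖(chi d : ℂ)‖ * d ≤ 1 * n := by gcongr; exact norm_chi_le _
      _ = n := one_mul _
  · simpa using mod_cast Nat.card_divisors_le_self n

theorem norm_S_le (n : ℕ) : ‖S n‖ ≤ 3 * √3 * n := by
  have : ‖(3 * √3 * I : ℂ)‖ = 3 * √3 := by simp [abs_of_nonneg]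
  rw [S, norm_mul, this]
  gcongr
  refine (norm_sum_le_of_le (f := fun d : ℕ ↦ (chi d : ℂ) / d) _ (n := fun _ ↦ 1) ?_).trans ?_
  · intro d hd
    have hd' : (1 : ℝ) ≤ d := mod_cast Nat.pos_of_mem_divisors hd
    rw [norm_div, norm_natCast]
    exact div_le_one_of_le₀ ((norm_chi_le _).trans hd') (by positivity)
  · simpa using mod_cast Nat.card_divisors_le_self n

theorem natCast_mul_S (n : ℕ) :
    n * S n = 3 * √3 * I * ∑ x ∈ n.divisorsAntidiagonal, (chi x.1 : ℂ) * x.2 := by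
  rw [S, mul_left_comm, Finset.mul_sum,
    Nat.sum_divisorsAntidiagonal (f := fun d m : ℕ ↦ (chi d : ℂ) * m)]
  congr 1
  refine Finset.sum_congr rfl fun d hd ↦ ?_
  rw [Nat.cast_div (Nat.dvd_of_mem_divisors hd)
    (mod_cast (Nat.pos_of_mem_divisors hd).ne')]
  ring

theorem natCast_mul_R {n : ℕ} (hn : n ≠ 0) :
    n * R n = 3 * ∑ x ∈ n.divisorsAntidiagonal, (chi x.1 : ℂ) * x.1 := by
  rw [R, mul_left_comm, Finset.mul_sum,
    Nat.sum_divisorsAntidiagonal (f := fun d _ : ℕ ↦ (chi d : ℂ) * d)]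
  congr 1
  refine Finset.sum_congr rfl fun d hd ↦ ?_
  have : (n : ℂ) ≠ 0 := mod_cast hn
  field_simp

theorem tsum_sum_divisorsAntidiagonal_mul_pow {ψ : ℕ → ℕ → ℂ} {r : ℂ}
    (h : Summable fun c : ℕ+ × ℕ+ ↦ ψ c.1 c.2 * r ^ (c.1 * c.2 : ℕ)) :
    ∑' n : ℕ, (∑ x ∈ (n + 1).divisorsAntidiagonal, ψ x.1 x.2) * r ^ (n + 1) =
      ∑' c : ℕ+ × ℕ+, ψ c.1 c.2 * r ^ (c.1 * c.2 : ℕ) := by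
  rw [← tsum_pnat_eq_tsum_succ
    (f := fun n : ℕ ↦ (∑ x ∈ n.divisorsAntidiagonal, ψ x.1 x.2) * r ^ n)]
  have h' := sigmaAntidiagonalEquivProd.summable_iff.mpr h
  rw [← sigmaAntidiagonalEquivProd.tsum_eq]
  refine Eq.trans ?_ (Summable.tsum_sigma h').symm
  refine tsum_congr fun n ↦ ?_
  rw [tsum_fintype, Finset.sum_mul, Finset.univ_eq_attach,
    ← Finset.sum_attach _ (fun x : ℕ × ℕ ↦ ψ x.1 x.2 * r ^ (n : ℕ))]
  refine Finset.sum_congr rfl fun x _ ↦ ?_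
  exact congrArg (fun e : ℕ ↦ ψ x.1.1 x.1.2 * r ^ e) (Nat.mem_divisorsAntidiagonal.mp x.2).1.symm

theorem summable_chi_mul_snd {r : ℂ} (hr : ‖r‖ < 1) :
    Summable fun c : ℕ+ × ℕ+ ↦ (chi (c.1 : ℕ) : ℂ) * (c.2 : ℕ) * r ^ (c.1 * c.2 : ℕ) := by
  refine .of_norm_bounded (summable_prod_mul_pow 1 hr).norm fun c ↦ ?_
  rw [pow_one, mul_assoc, norm_mul]
  exact mul_le_of_le_one_left (norm_nonneg _) (norm_chi_le _)

theorem summable_chi_mul_fst {r : ℂ} (hr : ‖r‖ < 1) :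
    Summable fun c : ℕ+ × ℕ+ ↦ (chi (c.1 : ℕ) : ℂ) * (c.1 : ℕ) * r ^ (c.1 * c.2 : ℕ) := by
  refine .of_norm_bounded (summable_prod_mul_pow 1 hr).prod_symm.norm fun c ↦ ?_
  rw [mul_assoc, norm_mul]
  refine (mul_le_of_le_one_left (norm_nonneg _) (norm_chi_le _)).trans (le_of_eq ?_)
  simp [mul_comm (c.1 : ℕ)]

theorem tsum_chi_mul {f : ℕ → ℂ} (h : Summable fun n : ℕ+ ↦ (chi (n : ℕ) : ℂ) * f n) :
    ∑' n : ℕ+, (chi (n : ℕ) : ℂ) * f n = ∑' k : ℕ, (f (3 * k + 1) - f (3 * k + 2)) := by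
  have h' : Summable fun n : ℕ ↦ (chi n : ℂ) * f n :=
    (summable_nat_add_iff 1).mp (summable_pnat_iff_summable_succ
      (f := fun n : ℕ ↦ (chi n : ℂ) * f n) |>.mp h)
  have h0 (k : ℕ) : (chi (0 + 3 * k : ℕ) : ℂ) * f (0 + 3 * k) = 0 := by
    have : chi (0 + 3 * k : ℕ) = 0 := by
      rw [chi, if_neg (by lia), if_neg (by lia)]
    rw [this, Int.cast_zero, zero_mul]
  have h1 (k : ℕ) : (chi (1 + 3 * k : ℕ) : ℂ) * f (1 + 3 * k) = f (3 * k + 1) := by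
    have : chi (1 + 3 * k : ℕ) = 1 := by
      rw [chi, if_pos (by lia)]
    rw [this, add_comm 1, Int.cast_one, one_mul]
  have h2 (k : ℕ) : (chi (2 + 3 * k : ℕ) : ℂ) * f (2 + 3 * k) = -f (3 * k + 2) := by
    have : chi (2 + 3 * k : ℕ) = -1 := by
      rw [chi, if_neg (by lia), if_pos (by lia)]
    rw [this, add_comm 2, Int.cast_neg, Int.cast_one, neg_one_mul]
  have s1 : Summable fun k : ℕ ↦ f (3 * k + 1) := by
    refine (h'.comp_injective (i := fun k : ℕ ↦ 1 + 3 * k) fun a b hab ↦ ?_).congr h1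
    simpa using hab
  have s2 : Summable fun k : ℕ ↦ f (3 * k + 2) := by
    refine summable_neg_iff.mp
      ((h'.comp_injective (i := fun k : ℕ ↦ 2 + 3 * k) fun a b hab ↦ ?_).congr h2)
    simpa using hab
  have e0 : ∑' n : ℕ+, (chi (n : ℕ) : ℂ) * f n = ∑' n : ℕ, (chi n : ℂ) * f n := by
    rw [h'.tsum_eq_zero_add, tsum_pnat_eq_tsum_succ (f := fun n : ℕ ↦ (chi n : ℂ) * f n)]
    simp [chi]
  rw [e0, Nat.sumByResidueClasses h' 3, s1.tsum_sub s2, sub_eq_add_neg, ← tsum_neg]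
  refine (Fin.sum_univ_three _).trans ?_
  change ∑' k : ℕ, (chi (0 + 3 * k : ℕ) : ℂ) * f (0 + 3 * k) +
    ∑' k : ℕ, (chi (1 + 3 * k : ℕ) : ℂ) * f (1 + 3 * k) +
    ∑' k : ℕ, (chi (2 + 3 * k : ℕ) : ℂ) * f (2 + 3 * k) = _
  rw [tsum_congr h0, tsum_congr h1, tsum_congr h2, tsum_zero, zero_add]

/-- The Lipschitz formula in weight two. -/
theorem tsum_int_one_div_add_sq {z : ℂ} (hz : 0 < z.im) :
    ∑' m : ℤ, 1 / (z + m) ^ 2 = -(4 * π ^ 2) * ∑' m : ℕ+, (m : ℕ) * exp (2 * π * I * z) ^ (m : ℕ) := by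
  have := EisensteinSeries.qExpansion_identity_pnat (k := 1) le_rfl ⟨z, hz⟩
  simp only [pow_one, Nat.factorial_one, Nat.cast_one, div_one] at this
  refine this.trans ?_
  congr 1
  norm_num [mul_pow]

theorem summable_int_one_div_add_sq (n : ℕ) (z : ℂ) :
    Summable fun m : ℤ ↦ 1 / (n * z + m) ^ 2 := by
  simpa using EisensteinSeries.linear_right_summable z n (k := 2) le_rfl

theorem exp_pow_sub_exp_pow (d : ℕ) :
    exp (2 * π * I * (1 / 3)) ^ d - exp (2 * π * I * (2 / 3)) ^ d = I * √3 * chi d := by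
  have h3 : ((√3 : ℝ) : ℂ) ^ 2 = 3 := by
    rw [← ofReal_pow, Real.sq_sqrt (by norm_num)]
    norm_num
  have e1 : exp (2 * π * I * (1 / 3)) = -(1 / 2) + √3 / 2 * I := by
    have : 2 * π * I * (1 / 3) = ((π - π / 3 : ℝ) : ℂ) * I := by
      push_cast
      ring
    rw [this, exp_mul_I, ← ofReal_cos, ← ofReal_sin, Real.cos_pi_sub, Real.sin_pi_sub,
      Real.cos_pi_div_three, Real.sin_pi_div_three]
    push_cast
    ring
  have e2 : exp (2 * π * I * (2 / 3)) = exp (2 * π * I * (1 / 3)) ^ 2 := by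
    rw [← exp_nat_mul]
    congr 1
    push_cast
    ring
  rw [e2, e1, ← pow_mul]
  generalize hω : (-(1 / 2) + √3 / 2 * I : ℂ) = ω
  have w2 : ω ^ 2 = -(1 / 2) - √3 / 2 * I := by
    rw [← hω]
    linear_combination (I ^ 2 / 4) * h3 + 3 / 4 * I_sq
  have w3 : ω ^ 3 = 1 := by
    rw [pow_succ, w2, ← hω]
    linear_combination -(I ^ 2 / 4) * h3 - 3 / 4 * I_sq
  have hd : d = d % 3 + 3 * (d / 3) := (Nat.mod_add_div d 3).symm
  have p1 : ω ^ d = ω ^ (d % 3) := by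
    conv_lhs => rw [hd, pow_add, pow_mul, w3, one_pow, mul_one]
  have p2 : ω ^ (2 * d) = ω ^ (d % 3) * ω ^ (d % 3) := by
    rw [mul_comm, pow_mul, p1, sq]
  rw [p1, p2]
  have hlt : d % 3 < 3 := Nat.mod_lt _ (by norm_num)
  have hc : chi d = if d % 3 = 1 then 1 else if d % 3 = 2 then -1 else 0 := by
    unfold chi
    norm_cast
  rw [hc]
  interval_cases d % 3
  · norm_num
  · norm_num
    linear_combination -w2 - hω
  · norm_num
    linear_combination w2 - ω * w3 + hω

theorem neg_mem_slitPlane_of_im_pos {y : ℂ} (hy : 0 < y.im) : -y ∈ slitPlane :=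
  Or.inr (by simpa using hy.ne')

theorem mem_slitPlane_of_im_pos {y : ℂ} (hy : 0 < y.im) : y ∈ slitPlane :=
  Or.inr hy.ne'

theorem norm_exp_two_pi_I_mul_lt_one {y : ℂ} (hy : 0 < y.im) : ‖exp (2 * π * I * y)‖ < 1 :=
  UpperHalfPlane.norm_exp_two_pi_I_lt_one ⟨y, hy⟩

theorem exp_two_pi_I_mul_succ (n : ℕ) (y : ℂ) :
    exp (2 * π * I * (n + 1) * y) = exp (2 * π * I * y) ^ (n + 1) := by
  rw [← exp_nat_mul]
  congr 1
  push_cast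
  ring

/-- The value `L(2, χ)`, with the terms `3 k + 1` and `3 k + 2` grouped together. -/
def chiZetaTwo : ℂ := ∑' k : ℕ, (1 / (3 * k + 1 : ℂ) ^ 2 - 1 / (3 * k + 2 : ℂ) ^ 2)

theorem summable_one_div_three_mul_add_sq (a : ℕ) :
    Summable fun k : ℕ ↦ 1 / (3 * k + a : ℂ) ^ 2 := by
  have h : Summable fun n : ℕ ↦ 1 / (n : ℂ) ^ 2 := by
    have := (Real.summable_one_div_nat_pow (p := 2)).mpr one_lt_two
    exact (Complex.summable_ofReal.mpr this).congr fun n ↦ by push_cast; rfl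
  refine (h.comp_injective (i := fun k : ℕ ↦ 3 * k + a) fun x z hxz ↦ ?_).congr fun k ↦ ?_
  · simpa using hxz
  · simp

theorem tsum_int_sub_eq_latticeTerm {y : ℂ} (hy : 0 < y.im) (k : ℕ) :
    (∑' m : ℤ, 1 / ((3 * k + 1 : ℕ) * y + m) ^ 2) - ∑' m : ℤ, 1 / ((3 * k + 2 : ℕ) * y + m) ^ 2 =
      ∑' m : ℕ, latticeTerm (k, m) y
        + 1 / y ^ 2 * (1 / (3 * k + 1 : ℂ) ^ 2 - 1 / (3 * k + 2 : ℂ) ^ 2)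
        + ∑' m : ℕ, latticeTerm (k, m) (-y) := by
  have s1 := summable_int_one_div_add_sq (3 * k + 1 : ℕ) y
  have s2 := summable_int_one_div_add_sq (3 * k + 2 : ℕ) y
  rw [← s1.tsum_sub s2]
  have t1 := (hasSum_latticeTerm (mem_slitPlane_of_im_pos hy)).summable.prod_factor k
  have t2 := (hasSum_latticeTerm (neg_mem_slitPlane_of_im_pos hy)).summable.prod_factor k
  have e1 (m : ℕ) : latticeTerm (k, m) y = 1 / (((3 * k + 1 : ℕ) : ℂ) * y + ((m + 1 : ℤ) : ℂ)) ^ 2 -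
      1 / (((3 * k + 2 : ℕ) : ℂ) * y + ((m + 1 : ℤ) : ℂ)) ^ 2 := by
    simp [latticeTerm]
  have e2 (m : ℕ) : latticeTerm (k, m) (-y) =
      1 / (((3 * k + 1 : ℕ) : ℂ) * y + ((-(m + 1) : ℤ) : ℂ)) ^ 2 -
      1 / (((3 * k + 2 : ℕ) : ℂ) * y + ((-(m + 1) : ℤ) : ℂ)) ^ 2 := by
    rw [latticeTerm]
    push_cast
    congr 2 <;> ring
  rw [tsum_congr e1, tsum_congr e2]
  refine (tsum_of_add_one_of_neg_add_one (t1.congr e1) (t2.congr e2)).trans ?_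
  congr 2
  push_cast
  rw [add_zero, add_zero, mul_pow, mul_pow, one_div_mul_eq_div, sub_div, div_div, div_div]

theorem tsum_S_deriv {y : ℂ} (hy : 0 < y.im) :
    ∑' n : ℕ, 2 * π * I * ((n + 1 : ℕ) * S (n + 1)) * exp (2 * π * I * (n + 1) * y) =
      3 * √3 / (2 * π) * (∑' p, latticeTerm p y + 1 / y ^ 2 * chiZetaTwo +
        ∑' p, latticeTerm p (-y)) := by
  have hr := norm_exp_two_pi_I_mul_lt_one hy
  have hπ : (π : ℂ) ≠ 0 := by exact_mod_cast Real.pi_ne_zero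
  set r := exp (2 * π * I * y) with hr_def
  have hs := summable_chi_mul_snd hr
  have e1 (n : ℕ) : 2 * π * I * ((n + 1 : ℕ) * S (n + 1)) * exp (2 * π * I * (n + 1) * y) =
      -(6 * √3 * π) *
        ((∑ x ∈ (n + 1).divisorsAntidiagonal, (chi x.1 : ℂ) * x.2) * r ^ (n + 1)) := by
    rw [natCast_mul_S, exp_two_pi_I_mul_succ, ← hr_def]
    linear_combination (6 * π * √3 *
      ((∑ x ∈ (n + 1).divisorsAntidiagonal, (chi x.1 : ℂ) * x.2) * r ^ (n + 1))) * I_sq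
  have e2 (d : ℕ+) : ∑' m : ℕ+, (chi (d : ℕ) : ℂ) * (m : ℕ) * r ^ (d * m : ℕ) =
      -(1 / (4 * π ^ 2)) * ((chi (d : ℕ) : ℂ) * ∑' m : ℤ, 1 / ((d : ℕ) * y + m) ^ 2) := by
    have hd : 0 < (((d : ℕ) : ℂ) * y).im := by
      have : (0 : ℝ) < (d : ℕ) := by exact_mod_cast d.pos
      simpa using mul_pos this hy
    have hexp : exp (2 * π * I * (((d : ℕ) : ℂ) * y)) = r ^ (d : ℕ) := by
      rw [hr_def, ← exp_nat_mul]
      congr 1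
      ring
    rw [tsum_int_one_div_add_sq hd, hexp]
    simp only [mul_assoc, tsum_mul_left, pow_mul]
    field_simp
  have hsum : Summable fun d : ℕ+ ↦
      (chi (d : ℕ) : ℂ) * ∑' m : ℤ, 1 / (((d : ℕ) : ℂ) * y + m) ^ 2 := by
    refine (summable_mul_left_iff (a := -(1 / (4 * π ^ 2) : ℂ)) (by simp [hπ])).mp ?_
    exact hs.prod.congr e2
  have u1 := (hasSum_latticeTerm (mem_slitPlane_of_im_pos hy)).summable
  have u2 := (hasSum_latticeTerm (neg_mem_slitPlane_of_im_pos hy)).summable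
  have u3 : Summable fun k : ℕ ↦ (1 / (3 * k + 1 : ℂ) ^ 2 - 1 / (3 * k + 2 : ℂ) ^ 2) := by
    simpa using (summable_one_div_three_mul_add_sq 1).sub (summable_one_div_three_mul_add_sq 2)
  rw [tsum_congr e1, tsum_mul_left,
    tsum_sum_divisorsAntidiagonal_mul_pow (ψ := fun d m : ℕ ↦ (chi d : ℂ) * m) hs, hs.tsum_prod,
    tsum_congr e2, tsum_mul_left,
    tsum_chi_mul (f := fun d : ℕ ↦ ∑' m : ℤ, 1 / ((d : ℂ) * y + m) ^ 2) hsum,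
    tsum_congr (tsum_int_sub_eq_latticeTerm hy),
    (u1.prod.add (u3.mul_left (1 / y ^ 2))).tsum_add u2.prod,
    u1.prod.tsum_add (u3.mul_left (1 / y ^ 2)), tsum_mul_left, u1.tsum_prod, u2.tsum_prod,
    chiZetaTwo]
  field_simp
  ring

theorem tsum_chi_mul_pow {w : ℂ} (hw : 0 < w.im) :
    ∑' d : ℕ+, (chi (d : ℕ) : ℂ) * (d : ℕ) * exp (2 * π * I * w) ^ (d : ℕ) =
      I / (4 * √3 * π ^ 2) *
        ∑' k : ℤ, (1 / (w + 1 / 3 + k) ^ 2 - 1 / (w + 2 / 3 + k) ^ 2) := by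
  have hπ : (π : ℂ) ≠ 0 := by exact_mod_cast Real.pi_ne_zero
  have h3 : ((√3 : ℝ) : ℂ) ≠ 0 := by exact_mod_cast (show √3 ≠ 0 by positivity)
  have h1 : 0 < (w + 1 / 3).im := by simpa using hw
  have h2 : 0 < (w + 2 / 3).im := by simpa using hw
  have s (z : ℂ) : Summable fun k : ℤ ↦ 1 / (z + k) ^ 2 := by
    simpa using summable_int_one_div_add_sq 1 z
  have q {z : ℂ} (hz : 0 < z.im) :
      Summable fun m : ℕ+ ↦ ((m : ℕ) : ℂ) * exp (2 * π * I * z) ^ (m : ℕ) := by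
    simpa using! (summable_pow_mul_geometric_of_norm_lt_one 1
      (norm_exp_two_pi_I_mul_lt_one hz)).comp_injective PNat.coe_injective
  rw [(s _).tsum_sub (s _), tsum_int_one_div_add_sq h1, tsum_int_one_div_add_sq h2, ← mul_sub,
    ← (q h1).tsum_sub (q h2), ← tsum_mul_left, ← tsum_mul_left]
  refine tsum_congr fun d ↦ ?_
  rw [mul_add, mul_add, exp_add, exp_add, mul_pow, mul_pow]
  have key := exp_pow_sub_exp_pow d
  set E := exp (2 * π * I * w) ^ (d : ℕ)
  have : I / (4 * √3 * π ^ 2) * (-(4 * π ^ 2) *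
      ((d : ℕ) * (E * exp (2 * π * I * (1 / 3)) ^ (d : ℕ)) -
        (d : ℕ) * (E * exp (2 * π * I * (2 / 3)) ^ (d : ℕ)))) =
      -I / √3 * ((d : ℕ) * E) * (exp (2 * π * I * (1 / 3)) ^ (d : ℕ) -
        exp (2 * π * I * (2 / 3)) ^ (d : ℕ)) := by
    field_simp
  rw [this, key]
  field_simp
  linear_combination (E * chi (d : ℕ)) * I_sq

theorem tsum_int_sub_eq_latticeTerm_swap {y : ℂ} (hy : 0 < y.im) (m : ℕ) :
    ∑' k : ℤ, (1 / ((m + 1 : ℕ) * (-1 / (3 * y)) + 1 / 3 + k) ^ 2 -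
        1 / ((m + 1 : ℕ) * (-1 / (3 * y)) + 2 / 3 + k) ^ 2) =
      9 * y ^ 2 * (∑' k : ℕ, latticeTerm (k, m) (-y) - ∑' k : ℕ, latticeTerm (k, m) y) := by
  have hy0 : y ≠ 0 := by
    rintro rfl
    simp at hy
  have t1 := (hasSum_latticeTerm (mem_slitPlane_of_im_pos hy)).summable.prod_symm.prod_factor m
  have t2 := (hasSum_latticeTerm (neg_mem_slitPlane_of_im_pos hy)).summable.prod_symm.prod_factor m
  have sc (c k : ℂ) : 1 / ((m + 1 : ℕ) * (-1 / (3 * y)) + c / 3 + k) ^ 2 =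
      9 * y ^ 2 * (1 / ((3 * k + c) * y - (m + 1)) ^ 2) := by
    have : (m + 1 : ℕ) * (-1 / (3 * y)) + c / 3 + k = ((3 * k + c) * y - (m + 1)) / (3 * y) := by
      push_cast
      field_simp
      ring
    rw [this, div_pow, one_div_div, mul_pow]
    ring
  have e1 (k : ℕ) : latticeTerm (k, m) (-y) = 1 / ((3 * ((k : ℤ) : ℂ) + 1) * y - (m + 1)) ^ 2 -
      1 / ((3 * ((k : ℤ) : ℂ) + 2) * y - (m + 1)) ^ 2 := by
    rw [latticeTerm]
    push_cast
    congr 2 <;> ring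
  have e2 (k : ℕ) : -latticeTerm (k, m) y =
      1 / ((3 * ((-(k + 1) : ℤ) : ℂ) + 1) * y - (m + 1)) ^ 2 -
      1 / ((3 * ((-(k + 1) : ℤ) : ℂ) + 2) * y - (m + 1)) ^ 2 := by
    rw [latticeTerm, neg_sub]
    push_cast
    congr 2 <;> ring
  simp only [sc, ← mul_sub, tsum_mul_left]
  rw [sub_eq_add_neg (∑' k : ℕ, latticeTerm (k, m) (-y)), ← tsum_neg, tsum_congr e1, tsum_congr e2]
  congr 1
  exact tsum_of_nat_of_neg_add_one (t2.congr e1) (t1.neg.congr e2)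

theorem im_neg_one_div_pos {y : ℂ} (hy : 0 < y.im) : 0 < (-1 / (3 * y)).im := by
  have : -1 / (3 * y) = ((1 / 3 : ℝ) : ℂ) * (-y⁻¹) := by
    push_cast
    rw [div_eq_mul_inv, mul_inv]
    ring
  rw [this, im_ofReal_mul, neg_im, inv_im, neg_div, neg_neg]
  have : 0 < normSq y := normSq_pos.mpr fun h ↦ by simp [h] at hy
  positivity

theorem tsum_R_deriv {y : ℂ} (hy : 0 < y.im) :
    ∑' n : ℕ, 2 * π * I * ((n + 1 : ℕ) * R (n + 1)) * exp (2 * π * I * (n + 1) * (-1 / (3 * y))) =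
      9 * √3 * y ^ 2 / (2 * π) * (∑' p, latticeTerm p y - ∑' p, latticeTerm p (-y)) := by
  have hτ := im_neg_one_div_pos hy
  have hr := norm_exp_two_pi_I_mul_lt_one hτ
  have hπ : (π : ℂ) ≠ 0 := by exact_mod_cast Real.pi_ne_zero
  have h3 : ((√3 : ℝ) : ℂ) ≠ 0 := by exact_mod_cast (show √3 ≠ 0 by positivity)
  have h3' : ((√3 : ℝ) : ℂ) ^ 2 = 3 := by
    rw [← ofReal_pow, Real.sq_sqrt (by norm_num)]
    norm_num
  set r := exp (2 * π * I * (-1 / (3 * y))) with hr_def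
  have hs := summable_chi_mul_fst hr
  have e1 (n : ℕ) :
      2 * π * I * ((n + 1 : ℕ) * R (n + 1)) * exp (2 * π * I * (n + 1) * (-1 / (3 * y))) =
      (6 * π * I) *
        ((∑ x ∈ (n + 1).divisorsAntidiagonal, (chi x.1 : ℂ) * x.1) * r ^ (n + 1)) := by
    rw [natCast_mul_R n.succ_ne_zero, exp_two_pi_I_mul_succ, ← hr_def]
    ring
  have e2 (m : ℕ) : ∑' d : ℕ+, (chi (d : ℕ) : ℂ) * (d : ℕ) * r ^ (d * (m + 1) : ℕ) =
      I / (4 * √3 * π ^ 2) * (9 * y ^ 2 *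
        (∑' k : ℕ, latticeTerm (k, m) (-y) - ∑' k : ℕ, latticeTerm (k, m) y)) := by
    have hm : 0 < (((m + 1 : ℕ) : ℂ) * (-1 / (3 * y))).im := by
      rw [← ofReal_natCast, im_ofReal_mul]
      positivity
    have hexp : exp (2 * π * I * (((m + 1 : ℕ) : ℂ) * (-1 / (3 * y)))) = r ^ (m + 1) := by
      rw [hr_def, ← exp_nat_mul]
      congr 1
      ring
    have := tsum_chi_mul_pow hm
    rw [hexp, tsum_int_sub_eq_latticeTerm_swap hy] at this
    simpa only [← pow_mul, mul_comm (m + 1)] using this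
  have u1 := (hasSum_latticeTerm (mem_slitPlane_of_im_pos hy)).summable
  have u2 := (hasSum_latticeTerm (neg_mem_slitPlane_of_im_pos hy)).summable
  have w1 : Summable fun m : ℕ ↦ ∑' k : ℕ, latticeTerm (k, m) y := u1.prod_symm.prod
  have w2 : Summable fun m : ℕ ↦ ∑' k : ℕ, latticeTerm (k, m) (-y) := u2.prod_symm.prod
  have v1 : ∑' p, latticeTerm p y = ∑' (m : ℕ) (k : ℕ), latticeTerm (k, m) y := by
    rw [← (Equiv.prodComm ℕ ℕ).tsum_eq]
    exact u1.prod_symm.tsum_prod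
  have v2 : ∑' p, latticeTerm p (-y) = ∑' (m : ℕ) (k : ℕ), latticeTerm (k, m) (-y) := by
    rw [← (Equiv.prodComm ℕ ℕ).tsum_eq]
    exact u2.prod_symm.tsum_prod
  have v3 : ∑' c : ℕ+ × ℕ+, (chi (c.1 : ℕ) : ℂ) * (c.1 : ℕ) * r ^ (c.1 * c.2 : ℕ) =
      ∑' m : ℕ, ∑' d : ℕ+, (chi (d : ℕ) : ℂ) * (d : ℕ) * r ^ (d * (m + 1) : ℕ) := by
    rw [← tsum_pnat_eq_tsum_succ
      (f := fun m : ℕ ↦ ∑' d : ℕ+, (chi (d : ℕ) : ℂ) * (d : ℕ) * r ^ (d * m : ℕ)),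
      ← (Equiv.prodComm ℕ+ ℕ+).tsum_eq]
    exact hs.prod_symm.tsum_prod
  rw [tsum_congr e1, tsum_mul_left,
    tsum_sum_divisorsAntidiagonal_mul_pow (ψ := fun d _ : ℕ ↦ (chi d : ℂ) * d) hs, v3,
    tsum_congr e2, tsum_mul_left, tsum_mul_left, w2.tsum_sub w1, v1, v2]
  field_simp
  rw [I_sq, h3']
  ring

end

/-- `F_R(y) = f_∞(−1/(3y)) + f₀(y)` extends holomorphically to the cut plane
`ℂ ∖ ℝ_{≤0} = Complex.slitPlane`. -/
theorem stmt14 :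
    ∃ G : ℂ → ℂ, DifferentiableOn ℂ G Complex.slitPlane ∧
      ∀ y : ℂ, 0 < y.im → G y = finf (-1 / (3 * y)) + f0 y := by
  have hG (y : ℂ) (hy : y ∈ Complex.slitPlane) :
      HasDerivAt (fun w ↦ 3 * √3 / (2 * π) * (2 * ∑' p, latticePrim p w - w⁻¹ * chiZetaTwo))
        (3 * √3 / (2 * π) * (2 * ∑' p, latticeTerm p y + 1 / y ^ 2 * chiZetaTwo)) y := by
    refine ((((hasDerivAt_tsum_latticePrim hy).const_mul 2).sub
      ((hasDerivAt_inv (Complex.slitPlane_ne_zero hy)).mul_const chiZetaTwo)).const_mul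
      (3 * √3 / (2 * π) : ℂ)).congr_deriv ?_
    ring
  have hF (y : ℂ) (hy : 0 < y.im) : HasDerivAt (fun w ↦ finf (-1 / (3 * w)) + f0 w)
      (3 * √3 / (2 * π) * (2 * ∑' p, latticeTerm p y + 1 / y ^ 2 * chiZetaTwo)) y := by
    have hy0 : y ≠ 0 := Complex.slitPlane_ne_zero (mem_slitPlane_of_im_pos hy)
    have h1 := hasDerivAt_tsum_mul_exp norm_S_le hy
    have h2 := hasDerivAt_tsum_mul_exp norm_R_le (im_neg_one_div_pos hy)
    rw [tsum_S_deriv hy] at h1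
    rw [tsum_R_deriv hy] at h2
    have h3 : HasDerivAt (fun w : ℂ ↦ -1 / (3 * w)) (1 / (3 * y ^ 2)) y := by
      refine ((hasDerivAt_const y (-1 : ℂ)).div ((hasDerivAt_id y).const_mul 3)
        (mul_ne_zero three_ne_zero hy0)).congr_deriv ?_
      simp only [id]
      field_simp
      norm_num
    refine ((h2.comp y h3).add h1).congr_deriv ?_
    field_simp
    ring
  set G₀ : ℂ → ℂ := fun w ↦ 3 * √3 / (2 * π) * (2 * ∑' p, latticePrim p w - w⁻¹ * chiZetaTwo)
  have hU : IsOpen {y : ℂ | 0 < y.im} := isOpen_lt continuous_const Complex.continuous_im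
  have hD (y : ℂ) (hy : 0 < y.im) :
      HasDerivAt (fun w ↦ finf (-1 / (3 * w)) + f0 w - G₀ w) 0 y :=
    ((hF y hy).sub (hG y (mem_slitPlane_of_im_pos hy))).congr_deriv (sub_self _)
  obtain ⟨a, ha⟩ := hU.exists_is_const_of_deriv_eq_zero
    (convex_halfSpace_im_gt 0).isPreconnected
    (fun y hy ↦ (hD y hy).differentiableAt.differentiableWithinAt) (fun y hy ↦ (hD y hy).deriv)
  refine ⟨fun y ↦ G₀ y + a,
    fun y hy ↦ ((hG y hy).differentiableAt.add_const a).differentiableWithinAt, fun y hy ↦ ?_⟩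
  rw [← ha y hy]
  ring
end
end
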